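/- arXiv:2409.18112 — 2 statements merged into one kernel-verified Lean document; each statement's English description precedes it below -/
import Mathlib

section
/- Let X and Y be Polish spaces (with their Borel σ-algebras) and c : X × Y → [0,∞] a lower semicontinuous cost. If the Wasserstein cost space (𝒫(X) × 𝒫(Y), 𝒯_c), where 𝒫 denotes Borel probability measures, is an NNCC space, then (X × Y, c) is an NNCC space. -/
open MeasureTheory
open scoped ENNReal

/-- A variational c-segment on a cost space `(X × Y, c)` with cost valued in `[0, ∞]`. -/
def IsVarCSegment {X Y : Type*} (c : X → Y → ℝ≥0∞) (x : ℝ → X) (ybar : Y) : Prop :=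
  (∀ s ∈ Set.Icc (0:ℝ) 1, c (x s) ybar ≠ ⊤) ∧
  ∀ s ∈ Set.Ioo (0:ℝ) 1, ∀ y : Y,
    c (x s) ybar + ENNReal.ofReal (1 - s) * c (x 0) y + ENNReal.ofReal s * c (x 1) y ≤
      c (x s) y + ENNReal.ofReal (1 - s) * c (x 0) ybar + ENNReal.ofReal s * c (x 1) ybar

/-- `(X × Y, c)` is an NNCC space. -/
def IsNNCC {X Y : Type*} (c : X → Y → ℝ≥0∞) : Prop :=
  ∀ x0 x1 : X, ∀ ybar : Y, c x0 ybar ≠ ⊤ → c x1 ybar ≠ ⊤ →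
    ∃ x : ℝ → X, x 0 = x0 ∧ x 1 = x1 ∧ IsVarCSegment c x ybar

/-- The optimal transport cost `𝒯_c(μ, ν)`, an infimum over couplings of `(μ, ν)`. -/
noncomputable def transportCost {X Y : Type*} [MeasurableSpace X] [MeasurableSpace Y]
    (c : X → Y → ℝ≥0∞) (μ : ProbabilityMeasure X) (ν : ProbabilityMeasure Y) : ℝ≥0∞ :=
  ⨅ (π : {π : Measure (X × Y) // IsProbabilityMeasure π ∧
      π.map Prod.fst = (μ : Measure X) ∧ π.map Prod.snd = (ν : Measure Y)}),
    ∫⁻ q, c q.1 q.2 ∂(π : Measure (X × Y))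

open Set Filter Topology

theorem isCompact_setOf_forall_le (n : ℕ → ℕ) : IsCompact {σ : ℕ → ℕ | ∀ i, σ i ≤ n i} := by
  convert isCompact_univ_pi (fun i => (finite_Iic (n i)).isCompact) using 1
  ext σ
  simp [Pi.le_def]

/-- A compact box in the Baire space has a neighbourhood basis made of the cylinders obtained by
constraining finitely many coordinates. -/
theorem exists_cylinder_subset_of_isOpen {n : ℕ → ℕ} {W : Set (ℕ → ℕ)} (hW : IsOpen W)
    (hn : {σ : ℕ → ℕ | ∀ i, σ i ≤ n i} ⊆ W) :
    ∃ k, {σ : ℕ → ℕ | ∀ i < k, σ i ≤ n i} ⊆ W := by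
  by_contra! h
  simp only [not_subset] at h
  choose σ hσ hσW using h
  have hcomp : IsCompact {σ : ℕ → ℕ | ∀ i, σ i ≤ n i} := isCompact_setOf_forall_le n
  obtain ⟨τ, hτ, φ, hφ, hlim⟩ := hcomp.tendsto_subseq
    (x := fun k i => min (σ k i) (n i)) (fun k i => min_le_right _ _)
  have hlim' : Tendsto (σ ∘ φ) atTop (𝓝 τ) := by
    rw [tendsto_pi_nhds] at hlim ⊢
    intro i
    refine (hlim i).congr' ?_
    filter_upwards [hφ.tendsto_atTop.eventually_gt_atTop i] with k hk
    exact min_eq_left (hσ (φ k) i hk)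
  obtain ⟨k, hk⟩ := (hlim'.eventually (hW.mem_nhds (hn hτ))).exists
  exact hσW _ hk

/-- A continuous image of the Baire space which is not null contains the image of a compact set
with measurable image of positive measure. -/
theorem exists_isCompact_measure_image_ne_zero {X : Type*} [TopologicalSpace X] [T2Space X]
    [MeasurableSpace X] [BorelSpace X] (μ : Measure X) [IsFiniteMeasure μ] {f : (ℕ → ℕ) → X}
    (hf : Continuous f) (h : μ (range f) ≠ 0) :
    ∃ K : Set (ℕ → ℕ), IsCompact K ∧ μ (f '' K) ≠ 0 := by
  obtain ⟨t, ht0, ht⟩ := exists_between (pos_iff_ne_zero.2 h)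
  have step : ∀ (k : ℕ) (C : {C : Set (ℕ → ℕ) // t < μ (f '' C)}),
      ∃ N : ℕ, t < μ (f '' (C.1 ∩ {σ | σ k ≤ N})) := by
    rintro k ⟨C, hC⟩
    have hmono : Monotone fun N : ℕ => f '' (C ∩ {σ | σ k ≤ N}) := fun a b hab =>
      image_mono (inter_subset_inter_right _ fun σ (hσ : σ k ≤ a) => hσ.trans hab)
    have hU : ⋃ N : ℕ, f '' (C ∩ {σ | σ k ≤ N}) = f '' C := by
      rw [← image_iUnion, ← inter_iUnion]
      congr 1
      refine inter_eq_left.2 fun σ _ => mem_iUnion.2 ⟨σ k, ?_⟩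
      exact le_refl (σ k)
    rw [← hU, hmono.measure_iUnion] at hC
    exact lt_iSup_iff.1 hC
  choose N hN using step
  let C : ℕ → {C : Set (ℕ → ℕ) // t < μ (f '' C)} := fun k =>
    Nat.rec ⟨univ, by rwa [image_univ]⟩ (fun k C => ⟨_, hN k C⟩) k
  let n : ℕ → ℕ := fun k => N k (C k)
  have hC : ∀ k, (C k).1 = {σ : ℕ → ℕ | ∀ i < k, σ i ≤ n i} := by
    intro k
    induction k with
    | zero => simp [C]
    | succ k ih =>
      have : (C (k + 1)).1 = (C k).1 ∩ {σ | σ k ≤ n k} := rfl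
      rw [this, ih]
      ext σ
      simp only [mem_inter_iff, mem_ofPred_eq]
      exact Nat.forall_lt_succ_right.symm
  let K : Set (ℕ → ℕ) := {σ | ∀ i, σ i ≤ n i}
  have hK : IsCompact K := isCompact_setOf_forall_le n
  refine ⟨K, hK, ?_⟩
  have hsub : ⋂ k, closure (f '' (C k).1) ⊆ f '' K := by
    intro x hx
    by_contra hxK
    obtain ⟨U, V, hU, hV, hKU, hxV, hUV⟩ := (hK.image hf).separation_of_notMem hxK
    obtain ⟨k, hk⟩ := exists_cylinder_subset_of_isOpen (hU.preimage hf) (image_subset_iff.1 hKU)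
    rw [← hC] at hk
    obtain ⟨y, hyV, hyC⟩ := mem_closure_iff.1 (mem_iInter.1 hx k) V hV hxV
    exact hUV.le_bot ⟨image_subset_iff.2 hk hyC, hyV⟩
  have hanti : Antitone fun k => closure (f '' (C k).1) := antitone_nat_of_succ_le fun k =>
    closure_mono (image_mono inter_subset_left)
  have hle : t ≤ μ (⋂ k, closure (f '' (C k).1)) := by
    rw [hanti.measure_iInter (fun k => isClosed_closure.measurableSet.nullMeasurableSet)
      ⟨0, measure_ne_top _ _⟩]
    exact le_iInf fun k => (C k).2.le.trans (measure_mono subset_closure)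
  exact (ht0.trans_le (hle.trans (measure_mono hsub))).ne'

/-- A continuous map on a compact subset of the line has a measurable section on its range. -/
theorem exists_measurable_section_of_isCompact_real {X : Type*} [TopologicalSpace X] [T2Space X]
    [MeasurableSpace X] [BorelSpace X] {C : Set ℝ} (hC : IsCompact C) (hne : C.Nonempty)
    {p : C → X} (hp : Continuous p) :
    ∃ m : X → C, Measurable m ∧ ∀ x ∈ range p, p (m x) = x := by
  classical
  have : CompactSpace C := isCompact_iff_compactSpace.1 hC
  obtain ⟨r₀, hr₀⟩ := hne
  have hleast : ∀ x : range p, ∃ r : C, IsLeast (p ⁻¹' {x.1}) r := by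
    rintro ⟨_, r, rfl⟩
    exact (isClosed_singleton.preimage hp).isCompact.exists_isLeast ⟨r, rfl⟩
  choose l hl using hleast
  let m : X → C := fun x => if hx : x ∈ range p then l ⟨x, hx⟩ else ⟨r₀, hr₀⟩
  have hm : ∀ x (hx : x ∈ range p), m x = l ⟨x, hx⟩ := fun x hx => dif_pos hx
  have hm' : ∀ x, x ∉ range p → m x = ⟨r₀, hr₀⟩ := fun x hx => dif_neg hx
  refine ⟨m, ?_, fun x hx => by rw [hm x hx]; exact (hl ⟨x, hx⟩).1⟩
  have hmeas : Measurable fun x => (m x : ℝ) := by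
    refine measurable_of_Iic fun r => ?_
    have heq : (fun x => (m x : ℝ)) ⁻¹' Iic r =
        p '' {q : C | (q : ℝ) ≤ r} ∪ ((range p)ᶜ ∩ {_x | r₀ ≤ r}) := by
      ext x
      by_cases hx : x ∈ range p
      · simp only [mem_preimage, mem_Iic, mem_union, mem_inter_iff, mem_compl_iff, hx,
          not_true_eq_false, false_and, or_false, hm x hx]
        constructor
        · intro h
          exact ⟨_, h, (hl ⟨x, hx⟩).1⟩
        · rintro ⟨q, hq, hqx⟩
          exact le_trans (Subtype.coe_le_coe.2 ((hl ⟨x, hx⟩).2 hqx)) hq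
      · have hx' : x ∉ p '' {q : C | (q : ℝ) ≤ r} := fun h => hx (image_subset_range _ _ h)
        simp [hm' x hx, hx', hx, -mem_image, -mem_range]
    rw [heq]
    have hclosed : IsClosed {q : C | (q : ℝ) ≤ r} :=
      isClosed_le continuous_subtype_val continuous_const
    exact (hclosed.isCompact.image hp).measurableSet.union
      ((isCompact_range hp).measurableSet.compl.inter (MeasurableSet.const _))
  exact hmeas.subtype_mk

/-- A measurable set in a product of Polish spaces whose projection is not null contains the graph
of a measurable map over a measurable set of positive measure. -/
theorem exists_measurable_selection_of_measure_image_fst_ne_zero {X Y : Type*}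
    [MeasurableSpace X] [TopologicalSpace X] [PolishSpace X] [BorelSpace X]
    [MeasurableSpace Y] [TopologicalSpace Y] [PolishSpace Y] [BorelSpace Y]
    (μ : Measure X) [IsFiniteMeasure μ] {E : Set (X × Y)} (hE : MeasurableSet E)
    (h : μ (Prod.fst '' E) ≠ 0) :
    ∃ S : Set X, MeasurableSet S ∧ μ S ≠ 0 ∧
      ∃ T : X → Y, Measurable T ∧ ∀ x ∈ S, (x, T x) ∈ E := by
  have hA := hE.analyticSet
  rw [AnalyticSet] at hA
  obtain rfl | ⟨g, hg, rfl⟩ := hA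
  · simp at h
  rw [← range_comp] at h
  obtain ⟨K, hK, hμK⟩ := exists_isCompact_measure_image_ne_zero μ (continuous_fst.comp hg) h
  have hKne : K.Nonempty := by
    rw [nonempty_iff_ne_empty]
    rintro rfl
    simp at hμK
  let := TopologicalSpace.metrizableSpaceMetric (ℕ → ℕ)
  have : CompactSpace K := isCompact_iff_compactSpace.1 hK
  have : Nonempty K := hKne.to_subtype
  obtain ⟨φ, hφ, hφs⟩ := exists_nat_bool_continuous_surjective_of_compact K
  let q : cantorSet → X × Y := fun r => g (φ (cantorSetHomeomorphNatToBool r))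
  have hq : Continuous q := by fun_prop
  have hrange : range (Prod.fst ∘ q) = (Prod.fst ∘ g) '' K := by
    have : Prod.fst ∘ q = (Prod.fst ∘ g) ∘ Subtype.val ∘ φ ∘ cantorSetHomeomorphNatToBool := rfl
    rw [this, range_comp, range_comp,
      (hφs.comp cantorSetHomeomorphNatToBool.surjective).range_eq, image_univ, Subtype.range_coe]
  obtain ⟨m, hm, hmp⟩ := exists_measurable_section_of_isCompact_real isCompact_cantorSet
    ⟨0, zero_mem_cantorSet⟩ (continuous_fst.comp hq)
  refine ⟨_, (hK.image (continuous_fst.comp hg)).measurableSet, hμK,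
    fun x => (q (m x)).2, (continuous_snd.comp hq).measurable.comp hm, fun x hx => ?_⟩
  rw [← hrange] at hx
  refine ⟨φ (cantorSetHomeomorphNatToBool (m x)), ?_⟩
  exact Prod.ext (hmp x hx) rfl

section TransportCost

variable {X Y : Type*} [MeasurableSpace X] [MeasurableSpace Y] {c : X → Y → ℝ≥0∞}

theorem lintegral_le_transportCost_diracProba_left (hc : Measurable (Function.uncurry c))
    [MeasurableSingletonClass X] (x : X) (ν : ProbabilityMeasure Y) :
    ∫⁻ y, c x y ∂(ν : Measure Y) ≤ transportCost c (diracProba x) ν := by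
  refine le_iInf ?_
  rintro ⟨π, hπ, h₁, h₂⟩
  change _ ≤ ∫⁻ q, c q.1 q.2 ∂π
  clear hπ
  have hae : ∀ᵐ q ∂π, q.1 = x := by
    refine ae_of_ae_map (p := fun z => z = x) measurable_fst.aemeasurable ?_
    rw [h₁]
    exact (ae_dirac_iff (measurableSet_singleton x)).2 rfl
  rw [← h₂, lintegral_map hc.of_uncurry_left measurable_snd]
  refine lintegral_mono_ae ?_
  filter_upwards [hae] with q hq
  rw [hq]

theorem lintegral_le_transportCost_diracProba_right (hc : Measurable (Function.uncurry c))
    [MeasurableSingletonClass Y] (μ : ProbabilityMeasure X) (y : Y) :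
    ∫⁻ x, c x y ∂(μ : Measure X) ≤ transportCost c μ (diracProba y) := by
  refine le_iInf ?_
  rintro ⟨π, hπ, h₁, h₂⟩
  change _ ≤ ∫⁻ q, c q.1 q.2 ∂π
  clear hπ
  have hae : ∀ᵐ q ∂π, q.2 = y := by
    refine ae_of_ae_map (p := fun z => z = y) measurable_snd.aemeasurable ?_
    rw [h₂]
    exact (ae_dirac_iff (measurableSet_singleton y)).2 rfl
  rw [← h₁, lintegral_map hc.of_uncurry_right measurable_fst]
  refine lintegral_mono_ae ?_
  filter_upwards [hae] with q hq
  rw [hq]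

theorem transportCost_map_le (hc : Measurable (Function.uncurry c)) (μ : ProbabilityMeasure X)
    {T : X → Y} (hT : Measurable T) :
    transportCost c μ (μ.map hT.aemeasurable) ≤ ∫⁻ x, c x (T x) ∂(μ : Measure X) := by
  have hg : Measurable fun x => (x, T x) := measurable_id.prodMk hT
  have h₁ : ((μ : Measure X).map fun x => (x, T x)).map Prod.fst = μ := by
    rw [Measure.map_map measurable_fst hg]
    exact Measure.map_id
  have h₂ : ((μ : Measure X).map fun x => (x, T x)).map Prod.snd = μ.map hT.aemeasurable :=
    Measure.map_map measurable_snd hg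
  exact (iInf_le _ ⟨_, Measure.isProbabilityMeasure_map hg.aemeasurable, h₁, h₂⟩).trans_eq
    (lintegral_map hc hg)

theorem transportCost_diracProba_le (hc : Measurable (Function.uncurry c)) (x : X) (y : Y) :
    transportCost c (diracProba x) (diracProba y) ≤ c x y :=
  (iInf_le _ ⟨Measure.dirac (x, y), inferInstance, Measure.map_dirac' measurable_fst _,
    Measure.map_dirac' measurable_snd _⟩).trans_eq (lintegral_dirac' _ hc)

end TransportCost

/-- If a probability measure `μ` satisfies the integrated form of the variational inequality, then
some point satisfies the pointwise form. -/
theorem exists_variational_point_of_lintegral {X Y : Type*}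
    [MeasurableSpace X] [TopologicalSpace X] [PolishSpace X] [BorelSpace X]
    [MeasurableSpace Y] [TopologicalSpace Y] [PolishSpace Y] [BorelSpace Y]
    {c : X → Y → ℝ≥0∞} (hc : Measurable (Function.uncurry c)) {h : Y → ℝ≥0∞} (hh : Measurable h)
    {ybar : Y} (hy : h ybar ≠ ⊤) (μ : Measure X) [IsProbabilityMeasure μ]
    (hfin : ∫⁻ x, c x ybar ∂μ ≠ ⊤)
    (hμ : ∀ T : X → Y, Measurable T →
      ∫⁻ x, (c x ybar + h (T x)) ∂μ ≤ ∫⁻ x, (c x (T x) + h ybar) ∂μ) :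
    ∃ x, c x ybar ≠ ⊤ ∧ ∀ y, c x ybar + h y ≤ c x y + h ybar := by
  classical
  by_contra! hcon
  have hcy : Measurable fun x => c x ybar := hc.of_uncurry_right
  let E : Set (X × Y) := {q | c q.1 q.2 + h ybar < c q.1 ybar + h q.2}
  have hE : MeasurableSet E := measurableSet_lt (hc.add_const _)
    ((hcy.comp measurable_fst).add (hh.comp measurable_snd))
  have hproj : μ (Prod.fst '' E) ≠ 0 := by
    have hae : ∀ᵐ x ∂μ, x ∈ Prod.fst '' E := by
      filter_upwards [ae_lt_top hcy hfin] with x hx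
      obtain ⟨y, hy⟩ := hcon x hx.ne
      exact ⟨(x, y), hy, rfl⟩
    rw [measure_eq_measure_of_null_sdiff (subset_univ _) (by rwa [← compl_eq_univ_sdiff])]
    simp
  obtain ⟨S, hS, hμS, T, hT, hTE⟩ :=
    exists_measurable_selection_of_measure_image_fst_ne_zero μ hE hproj
  have hcT : Measurable fun x => c x (T x) := hc.comp (measurable_id.prodMk hT)
  obtain ⟨N, hN⟩ : ∃ N : ℕ, μ (S ∩ {x | c x (T x) ≤ N}) ≠ 0 := by
    by_contra! hnull
    refine hμS (measure_mono_null ?_ (measure_iUnion_null hnull))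
    intro x hx
    have hlt : c x (T x) ≠ ⊤ := ((le_self_add.trans_lt (hTE x hx)).trans_le le_top).ne
    obtain ⟨N, hN⟩ := ENNReal.exists_nat_gt hlt
    exact mem_iUnion.2 ⟨N, hx, hN.le⟩
  set R := S ∩ {x | c x (T x) ≤ N}
  have hR : MeasurableSet R := hS.inter (measurableSet_le hcT measurable_const)
  let T' : X → Y := R.piecewise T fun _ => ybar
  have hT' : Measurable T' := hT.piecewise hR measurable_const
  have hin : ∀ x ∈ R, T' x = T x := fun x hx => piecewise_eq_of_mem _ _ _ hx
  have hout : ∀ x ∉ R, T' x = ybar := fun x hx => piecewise_eq_of_notMem _ _ _ hx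
  have hbound : ∫⁻ x, (c x (T' x) + h ybar) ∂μ ≠ ⊤ := by
    have hle : ∫⁻ x, (c x (T' x) + h ybar) ∂μ ≤ ∫⁻ x, (c x ybar + (N + h ybar)) ∂μ := by
      refine lintegral_mono fun x => ?_
      by_cases hx : x ∈ R
      · simp only [hin x hx]
        exact (add_le_add_left hx.2 _).trans le_add_self
      · simp only [hout x hx]
        gcongr
        exact le_add_self
    refine ne_top_of_le_ne_top ?_ hle
    rw [lintegral_add_left hcy, lintegral_const, measure_univ, mul_one]
    finiteness
  refine (hμ T' hT').not_gt (lintegral_strict_mono_of_ae_le_of_ae_lt_on (s := R)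
    (hcy.add (hh.comp hT')).aemeasurable hbound (ae_of_all _ fun x => ?_) hN
    (ae_of_all _ fun x hx => ?_))
  · by_cases hx : x ∈ R
    · simp only [hin x hx]
      exact (hTE x hx.1).le
    · simp only [hout x hx, le_refl]
  · simp only [hin x hx]
    exact hTE x hx.1

/-- If the Wasserstein space `(𝒫(X) × 𝒫(Y), 𝒯_c)` is NNCC for a lower
semicontinuous cost on Polish spaces, then `(X × Y, c)` is NNCC. -/
theorem NNCC_of_wasserstein_NNCC
    {X Y : Type*}
    [MeasurableSpace X] [TopologicalSpace X] [PolishSpace X] [BorelSpace X]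
    [MeasurableSpace Y] [TopologicalSpace Y] [PolishSpace Y] [BorelSpace Y]
    (c : X → Y → ℝ≥0∞)
    (hlsc : LowerSemicontinuous (fun p : X × Y => c p.1 p.2))
    (hnncc : IsNNCC (transportCost c)) :
    IsNNCC c := by
  have hc : Measurable (Function.uncurry c) := hlsc.measurable
  intro x0 x1 ybar h0 h1
  obtain ⟨μ, hμ0, hμ1, hfin, hseg⟩ := hnncc (diracProba x0) (diracProba x1) (diracProba ybar)
    (ne_top_of_le_ne_top h0 (transportCost_diracProba_le hc x0 ybar))
    (ne_top_of_le_ne_top h1 (transportCost_diracProba_le hc x1 ybar))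
  have key : ∀ s ∈ Ioo (0 : ℝ) 1, ∃ x, c x ybar ≠ ⊤ ∧ ∀ y,
      c x ybar + (ENNReal.ofReal (1 - s) * c x0 y + ENNReal.ofReal s * c x1 y) ≤
        c x y + (ENNReal.ofReal (1 - s) * c x0 ybar + ENNReal.ofReal s * c x1 ybar) := by
    intro s hs
    have hm0 : Measurable (c x0) := hc.of_uncurry_left
    have hm1 : Measurable (c x1) := hc.of_uncurry_left
    have hmy : Measurable fun x => c x ybar := hc.of_uncurry_right
    refine exists_variational_point_of_lintegral hc
      (h := fun y => ENNReal.ofReal (1 - s) * c x0 y + ENNReal.ofReal s * c x1 y)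
      (by fun_prop) (by finiteness) (μ s : Measure X)
      (ne_top_of_le_ne_top (hfin s (Ioo_subset_Icc_self hs))
        (lintegral_le_transportCost_diracProba_right hc _ _)) fun T hT => ?_
    have hineq := hseg s hs ((μ s).map hT.aemeasurable)
    rw [hμ0, hμ1] at hineq
    have hpush : ∀ x, Measurable (c x) → ∫⁻ z, c x (T z) ∂(μ s : Measure X) ≤
        transportCost c (diracProba x) ((μ s).map hT.aemeasurable) := fun x hx => by
      refine le_trans (le_of_eq ?_) (lintegral_le_transportCost_diracProba_left hc _ _)
      exact (lintegral_map hx hT).symm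
    have hmT0 : Measurable fun z => c x0 (T z) := hm0.comp hT
    have hmT1 : Measurable fun z => c x1 (T z) := hm1.comp hT
    rw [lintegral_add_left hmy, lintegral_add_left (hmT0.const_mul _),
      lintegral_const_mul _ hmT0, lintegral_const_mul _ hmT1,
      lintegral_add_right _ measurable_const, lintegral_const, measure_univ, mul_one,
      ← add_assoc, ← add_assoc]
    refine le_trans ?_ (hineq.trans ?_)
    · gcongr
      · exact lintegral_le_transportCost_diracProba_right hc _ _
      · exact hpush x0 hm0
      · exact hpush x1 hm1
    · gcongr
      · exact transportCost_map_le hc _ hT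
      · exact transportCost_diracProba_le hc _ _
      · exact transportCost_diracProba_le hc _ _
  have : Nonempty X := ⟨x0⟩
  choose! z hz hzy using key
  let x : ℝ → X := fun s => if s = 0 then x0 else if s = 1 then x1 else z s
  have hx0 : x 0 = x0 := by simp [x]
  have hx1 : x 1 = x1 := by simp [x]
  have hx : ∀ s ∈ Ioo (0 : ℝ) 1, x s = z s := fun s hs => by simp [x, hs.1.ne', hs.2.ne]
  refine ⟨x, hx0, hx1, fun s hs => ?_, fun s hs y => ?_⟩
  · obtain rfl | hs0 := hs.1.eq_or_lt
    · rwa [hx0]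
    obtain rfl | hs1 := hs.2.eq_or_lt
    · rwa [hx1]
    rw [hx s ⟨hs0, hs1⟩]
    exact hz s ⟨hs0, hs1⟩
  · rw [hx0, hx1, hx s hs, add_assoc, add_assoc]
    exact hzy s hs y
end

section
/- Let X be a measurable space and let 𝒫(X) denote the set of probability measures on X. Then (𝒫(X) × 𝒫(X), KL), with KL the Kullback–Leibler divergence, is an NNCC space; moreover, for all μ₀, μ₁, ν ∈ 𝒫(X) with KL(μ₀,ν) < ∞ and KL(μ₁,ν) < ∞, the linear interpolation μ(s) = (1−s)·μ₀ + s·μ₁ together with the base point ν is a variational c-segment. -/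
open MeasureTheory
open scoped ENNReal

open Classical in
/-- The Kullback--Leibler divergence `KL(μ, ν) = ∫ log (dμ/dν) dμ` when `μ ≪ ν` and the
log-likelihood ratio is `μ`-integrable, and `+∞` otherwise. -/
noncomputable def KL {X : Type*} [MeasurableSpace X] (μ ν : Measure X) : ℝ≥0∞ :=
  if μ ≪ ν ∧ Integrable (fun x => Real.log ((μ.rnDeriv ν x).toReal)) μ
  then ENNReal.ofReal (∫ x, Real.log ((μ.rnDeriv ν x).toReal) ∂μ)
  else ⊤

open InformationTheory Classical in
theorem KL_eq_klDiv {X : Type*} [MeasurableSpace X] (μ ν : Measure X)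
    [IsProbabilityMeasure μ] [IsProbabilityMeasure ν] : KL μ ν = klDiv μ ν := by
  change (if μ ≪ ν ∧ Integrable (llr μ ν) μ then ENNReal.ofReal (∫ x, llr μ ν x ∂μ) else ⊤) = _
  by_cases h : μ ≪ ν ∧ Integrable (llr μ ν) μ
  · rw [klDiv_of_ac_of_integrable h.1 h.2, if_pos h]
    simp
  · rw [klDiv_eq_top_iff.2 fun h1 h2 => h ⟨h1, h2⟩, if_neg h]

open InformationTheory in
/-- Pointwise form of the compensation identity for `klFun`. -/
theorem klFun_compensation {a b f g₀ g₁ : ℝ} (hab : a + b = 1)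
    (hf : a * (g₀ * f) + b * (g₁ * f) = f) :
    a * klFun (g₀ * f) + b * klFun (g₁ * f) =
      klFun f + f * (a * klFun g₀ + b * klFun g₁) := by
  have key (g : ℝ) : klFun (g * f) = f * klFun g + g * f * Real.log f + 1 - f := by
    rcases eq_or_ne g 0 with rfl | hg
    · simp [klFun_apply]
    rcases eq_or_ne f 0 with rfl | hf0
    · simp [klFun_apply]
    simp only [klFun_apply, Real.log_mul hg hf0]
    ring
  rw [key, key, klFun_apply f]
  linear_combination Real.log f * hf + (1 - f) * hab

open InformationTheory in
/-- The compensation identity (also called Donald's identity) for the Kullback-Leibler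
divergence of a mixture. -/
theorem klDiv_compensation {X : Type*} [MeasurableSpace X] (μ₀ μ₁ σ : Measure X)
    [IsProbabilityMeasure μ₀] [IsProbabilityMeasure μ₁] [IsProbabilityMeasure σ]
    {a b : ℝ} (ha : 0 < a) (hb : 0 < b) (hab : a + b = 1) (m : Measure X)
    [IsProbabilityMeasure m] (hm : m = ENNReal.ofReal a • μ₀ + ENNReal.ofReal b • μ₁) :
    ENNReal.ofReal a * klDiv μ₀ σ + ENNReal.ofReal b * klDiv μ₁ σ =
      klDiv m σ + (ENNReal.ofReal a * klDiv μ₀ m + ENNReal.ofReal b * klDiv μ₁ m) := by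
  have ha' : ENNReal.ofReal a ≠ 0 := by simpa using ha
  have hb' : ENNReal.ofReal b ≠ 0 := by simpa using hb
  have h0m : μ₀ ≪ m :=
    (Measure.absolutelyContinuous_smul ha').trans (hm ▸ Measure.absolutelyContinuous_of_le
      (Measure.le_add_right le_rfl))
  have h1m : μ₁ ≪ m :=
    (Measure.absolutelyContinuous_smul hb').trans (hm ▸ Measure.absolutelyContinuous_of_le
      (Measure.le_add_left le_rfl))
  by_cases hmσ : m ≪ σ
  swap
  · rw [klDiv_of_not_ac hmσ, top_add]
    by_cases h0 : μ₀ ≪ σ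
    · have h1 : ¬ μ₁ ≪ σ := fun h1 =>
        hmσ (hm ▸ (h0.smul_left _).add_left (h1.smul_left _))
      rw [klDiv_of_not_ac h1, ENNReal.mul_top hb', add_top]
    · rw [klDiv_of_not_ac h0, ENNReal.mul_top ha', top_add]
  rw [klDiv_eq_lintegral_klFun_of_ac (h0m.trans hmσ),
    klDiv_eq_lintegral_klFun_of_ac (h1m.trans hmσ), klDiv_eq_lintegral_klFun_of_ac hmσ,
    klDiv_eq_lintegral_klFun_of_ac h0m, klDiv_eq_lintegral_klFun_of_ac h1m]
  have hmeas (μ ν : Measure X) :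
      Measurable fun x => ENNReal.ofReal (klFun (μ.rnDeriv ν x).toReal) :=
    (measurable_klFun.comp (Measure.measurable_rnDeriv μ ν).ennreal_toReal).ennreal_ofReal
  have hmeas_sum : Measurable fun x =>
      ENNReal.ofReal a * ENNReal.ofReal (klFun (μ₀.rnDeriv m x).toReal) +
        ENNReal.ofReal b * ENNReal.ofReal (klFun (μ₁.rnDeriv m x).toReal) :=
    ((hmeas _ _).const_mul _).add ((hmeas _ _).const_mul _)
  rw [← lintegral_const_mul _ (hmeas _ _), ← lintegral_const_mul _ (hmeas _ _),
    ← lintegral_const_mul _ (hmeas _ _), ← lintegral_const_mul _ (hmeas _ _),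
    ← lintegral_add_left ((hmeas _ _).const_mul _),
    ← lintegral_add_left ((hmeas _ _).const_mul _),
    ← lintegral_rnDeriv_mul hmσ hmeas_sum.aemeasurable,
    ← lintegral_add_left (hmeas _ _)]
  have hmix : m.rnDeriv σ =ᵐ[σ]
      ENNReal.ofReal a • μ₀.rnDeriv σ + ENNReal.ofReal b • μ₁.rnDeriv σ := by
    have h0 := Measure.rnDeriv_smul_left_of_ne_top μ₀ σ (ENNReal.ofReal_ne_top (r := a))
    have h1 := Measure.rnDeriv_smul_left_of_ne_top μ₁ σ (ENNReal.ofReal_ne_top (r := b))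
    have : IsFiniteMeasure (ENNReal.ofReal a • μ₀) := μ₀.smul_finite ENNReal.ofReal_ne_top
    have : IsFiniteMeasure (ENNReal.ofReal b • μ₁) := μ₁.smul_finite ENNReal.ofReal_ne_top
    rw [hm]
    exact (Measure.rnDeriv_add _ _ σ).trans (h0.add h1)
  refine lintegral_congr_ae ?_
  filter_upwards [hmix, Measure.rnDeriv_mul_rnDeriv h0m (κ := σ),
    Measure.rnDeriv_mul_rnDeriv h1m (κ := σ), m.rnDeriv_lt_top σ, μ₀.rnDeriv_lt_top σ,
    μ₁.rnDeriv_lt_top σ] with x hx h0 h1 hf hf0 hf1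
  simp only [Pi.add_apply, Pi.smul_apply, Pi.mul_apply, smul_eq_mul] at hx h0 h1 ⊢
  have hreal := congrArg ENNReal.toReal hx
  rw [ENNReal.toReal_add (by finiteness) (by finiteness), ENNReal.toReal_mul,
    ENNReal.toReal_mul, ENNReal.toReal_ofReal ha.le, ENNReal.toReal_ofReal hb.le,
    ← h0, ← h1, ENNReal.toReal_mul, ENNReal.toReal_mul] at hreal
  have hid := klFun_compensation hab hreal.symm
  have hn {y : ℝ≥0∞} : 0 ≤ klFun y.toReal := klFun_nonneg ENNReal.toReal_nonneg
  rw [← ENNReal.toReal_mul, ← ENNReal.toReal_mul, h0, h1] at hid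
  nth_rw 2 [← ENNReal.ofReal_toReal hf.ne]
  rw [← ENNReal.ofReal_mul ha.le, ← ENNReal.ofReal_mul hb.le, ← ENNReal.ofReal_mul ha.le,
    ← ENNReal.ofReal_mul hb.le, ← ENNReal.ofReal_add (mul_nonneg ha.le hn) (mul_nonneg hb.le hn),
    ← ENNReal.ofReal_add (mul_nonneg ha.le hn) (mul_nonneg hb.le hn),
    ← ENNReal.ofReal_mul ENNReal.toReal_nonneg,
    ← ENNReal.ofReal_add hn (mul_nonneg ENNReal.toReal_nonneg
      (add_nonneg (mul_nonneg ha.le hn) (mul_nonneg hb.le hn))), hid]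

theorem isProbabilityMeasure_mixture {X : Type*} [MeasurableSpace X] (μ₀ μ₁ : Measure X)
    [IsProbabilityMeasure μ₀] [IsProbabilityMeasure μ₁] {s : ℝ} (hs : s ∈ Set.Icc (0 : ℝ) 1) :
    IsProbabilityMeasure (ENNReal.ofReal (1 - s) • μ₀ + ENNReal.ofReal s • μ₁) := by
  constructor
  simp [← ENNReal.ofReal_add (sub_nonneg.2 hs.2) hs.1]

theorem isVarCSegment_KL_of_mixture {X : Type*} [MeasurableSpace X]
    (path : ℝ → ProbabilityMeasure X) (ν : ProbabilityMeasure X)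
    (hpath : ∀ s ∈ Set.Icc (0 : ℝ) 1, (path s : Measure X) =
      ENNReal.ofReal (1 - s) • (path 0 : Measure X) + ENNReal.ofReal s • (path 1 : Measure X))
    (h0 : KL (path 0 : Measure X) (ν : Measure X) ≠ ⊤)
    (h1 : KL (path 1 : Measure X) (ν : Measure X) ≠ ⊤) :
    IsVarCSegment (fun μ ν : ProbabilityMeasure X => KL (μ : Measure X) (ν : Measure X))
      path ν := by
  have key (s : ℝ) (hs : s ∈ Set.Ioo (0 : ℝ) 1) (y : ProbabilityMeasure X) :=
    klDiv_compensation (path 0 : Measure X) (path 1 : Measure X) (y : Measure X)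
      (sub_pos.2 hs.2) hs.1 (by ring) (path s : Measure X) (hpath s ⟨hs.1.le, hs.2.le⟩)
  simp only [← KL_eq_klDiv] at key
  refine ⟨fun s hs => ?_, fun s hs y => le_of_eq ?_⟩
  · rcases hs.1.eq_or_lt with rfl | hs0
    · exact h0
    rcases hs.2.eq_or_lt with rfl | hs1
    · exact h1
    refine ne_top_of_le_ne_top ?_ (le_self_add.trans_eq (key s ⟨hs0, hs1⟩ ν).symm)
    finiteness
  · simp only [add_assoc]
    rw [key s hs y, key s hs ν, add_left_comm]

/-- The space of probability measures with the Kullback--Leibler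
divergence is an NNCC space, and linear interpolation provides variational c-segments. -/
theorem KL_NNCC {X : Type*} [MeasurableSpace X] :
    IsNNCC (fun μ ν : ProbabilityMeasure X => KL (μ : Measure X) (ν : Measure X)) ∧
    ∀ μ0 μ1 ν : ProbabilityMeasure X,
      KL (μ0 : Measure X) (ν : Measure X) ≠ ⊤ →
      KL (μ1 : Measure X) (ν : Measure X) ≠ ⊤ →
      ∃ path : ℝ → ProbabilityMeasure X, path 0 = μ0 ∧ path 1 = μ1 ∧
        (∀ s ∈ Set.Icc (0:ℝ) 1,
          (path s : Measure X) =
            ENNReal.ofReal (1 - s) • (μ0 : Measure X)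
              + ENNReal.ofReal s • (μ1 : Measure X)) ∧
        IsVarCSegment
          (fun μ ν : ProbabilityMeasure X => KL (μ : Measure X) (ν : Measure X))
          path ν := by
  have main (μ0 μ1 ν : ProbabilityMeasure X) (h0 : KL (μ0 : Measure X) (ν : Measure X) ≠ ⊤)
      (h1 : KL (μ1 : Measure X) (ν : Measure X) ≠ ⊤) :
      ∃ path : ℝ → ProbabilityMeasure X, path 0 = μ0 ∧ path 1 = μ1 ∧
        (∀ s ∈ Set.Icc (0:ℝ) 1,
          (path s : Measure X) =
            ENNReal.ofReal (1 - s) • (μ0 : Measure X)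
              + ENNReal.ofReal s • (μ1 : Measure X)) ∧
        IsVarCSegment
          (fun μ ν : ProbabilityMeasure X => KL (μ : Measure X) (ν : Measure X))
          path ν := by
    have hmix (s : ℝ) : ∃ p : ProbabilityMeasure X, s ∈ Set.Icc (0 : ℝ) 1 → (p : Measure X) =
        ENNReal.ofReal (1 - s) • (μ0 : Measure X) + ENNReal.ofReal s • (μ1 : Measure X) := by
      by_cases hs : s ∈ Set.Icc (0 : ℝ) 1
      · exact ⟨⟨_, isProbabilityMeasure_mixture μ0 μ1 hs⟩, fun _ => rfl⟩
      · exact ⟨μ0, fun h => absurd h hs⟩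
    choose path hpath using hmix
    have hp0 : path 0 = μ0 := Subtype.ext ((hpath 0 (by simp)).trans (by simp))
    have hp1 : path 1 = μ1 := Subtype.ext ((hpath 1 (by simp)).trans (by simp))
    refine ⟨path, hp0, hp1, hpath, isVarCSegment_KL_of_mixture path ν ?_ ?_ ?_⟩
    · simpa only [hp0, hp1] using hpath
    · rwa [hp0]
    · rwa [hp1]
  refine ⟨fun x0 x1 ν h0 h1 => ?_, main⟩
  obtain ⟨path, hp0, hp1, -, hseg⟩ := main x0 x1 ν h0 h1
  exact ⟨path, hp0, hp1, hseg⟩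
end
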